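/- arXiv:2007.06864 — 2 statements merged into one kernel-verified Lean document; each statement's English description precedes it below -/
import Mathlib

section
/- Three-spheres inequality for the Helmholtz equation: let N ≥ 2 and k > 0. There exist positive constants s̃₀, C̃ and c̃₁ with 0 < c̃₁ < 1, depending only on k and N, such that for every 0 < s₁ < s < s₂ ≤ s̃₀, every t with s < t < s₂, and every smooth function u : B_{s₂} → ℂ satisfying Δu + k²u = 0 on B_{s₂}, there exists β with c̃₁ log(s₂/t)/log(s₂/s₁) ≤ β ≤ 1 − c̃₁ log(t/s₁)/log(s₂/s₁) such that ‖u‖_{L^∞(B_s)} ≤ C̃ (1 − s/t)^{−N/2} ‖u‖_{L^∞(B_{s₂})}^{1−β} ‖u‖_{L^∞(B_{s₁})}^{β}. -/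
open MeasureTheory Metric
open scoped ENNReal NNReal

/-- Partial derivative `∂f/∂x_j` of a scalar complex-valued function on `ℝ^N`. -/
noncomputable def pdc {N : ℕ} (f : EuclideanSpace ℝ (Fin N) → ℂ) (j : Fin N)
    (x : EuclideanSpace ℝ (Fin N)) : ℂ :=
  fderiv ℝ f x (EuclideanSpace.single j 1)

/-- Laplacian of a scalar complex-valued function on `ℝ^N`. -/
noncomputable def lapC {N : ℕ} (f : EuclideanSpace ℝ (Fin N) → ℂ)
    (x : EuclideanSpace ℝ (Fin N)) : ℂ :=
  ∑ j, pdc (pdc f j) j x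

/-- The Laplacian of a real-valued function on `ℝ^d`. -/
noncomputable def lapR {d : ℕ} (f : EuclideanSpace ℝ (Fin d) → ℝ)
    (x : EuclideanSpace ℝ (Fin d)) : ℝ :=
  ∑ i, fderiv ℝ (fun y => fderiv ℝ f y (EuclideanSpace.single i 1)) x (EuclideanSpace.single i 1)

/-- The radial weight `(1 - |x|²)₊`, supported in the unit ball. -/
noncomputable def ballWeight {d : ℕ} (x : EuclideanSpace ℝ (Fin d)) : ℝ :=
  max 0 (1 - ‖x‖ ^ 2)

lemma ballWeight_nonneg {d : ℕ} (x : EuclideanSpace ℝ (Fin d)) : 0 ≤ ballWeight x :=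
  le_max_left _ _

lemma continuous_ballWeight {d : ℕ} :
    Continuous (ballWeight : EuclideanSpace ℝ (Fin d) → ℝ) := by
  unfold ballWeight
  fun_prop

lemma ballWeight_eq_zero {d : ℕ} {x : EuclideanSpace ℝ (Fin d)} (hx : 1 ≤ ‖x‖) :
    ballWeight x = 0 := by
  unfold ballWeight
  apply max_eq_left
  nlinarith

lemma hasCompactSupport_ballWeight {d : ℕ} :
    HasCompactSupport (ballWeight : EuclideanSpace ℝ (Fin d) → ℝ) := by
  refine HasCompactSupport.intro (isCompact_closedBall (0 : EuclideanSpace ℝ (Fin d)) 1) ?_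
  intro x hx
  rw [mem_closedBall_zero_iff, not_le] at hx
  exact ballWeight_eq_zero hx.le

lemma integrable_mul_ballWeight {d : ℕ} {f : EuclideanSpace ℝ (Fin d) → ℝ} (hf : Continuous f) :
    Integrable fun x => f x * ballWeight x :=
  (hf.mul continuous_ballWeight).integrable_of_hasCompactSupport
    hasCompactSupport_ballWeight.mul_left

lemma integral_ballWeight_pos {d : ℕ} :
    0 < ∫ x : EuclideanSpace ℝ (Fin d), ballWeight x := by
  refine continuous_ballWeight.integral_pos_of_hasCompactSupport_nonneg_nonzero
    hasCompactSupport_ballWeight (fun x => ballWeight_nonneg x) (x := 0) ?_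
  simp [ballWeight]

lemma hasDerivAt_max_zero_sq (q : ℝ) :
    HasDerivAt (fun q : ℝ => max 0 q ^ 2) (2 * max 0 q) q := by
  rcases lt_trichotomy q 0 with hq | rfl | hq
  · have h : (fun q : ℝ => max 0 q ^ 2) =ᶠ[nhds q] fun _ => 0 := by
      filter_upwards [Iio_mem_nhds hq] with y hy
      simp [max_eq_left (Set.mem_Iio.1 hy).le]
    rw [max_eq_left hq.le, mul_zero]
    exact (hasDerivAt_const q (0 : ℝ)).congr_of_eventuallyEq h
  · have h : HasDerivAt (fun q : ℝ => q ^ 2) 0 0 := by simpa using hasDerivAt_pow 2 (0 : ℝ)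
    rw [hasDerivAt_iff_isLittleO] at h ⊢
    simp only [max_self, mul_zero, smul_zero, sub_zero] at h ⊢
    refine Asymptotics.IsBigO.trans_isLittleO (Asymptotics.isBigO_of_le _ fun y => ?_) h
    simp only [Real.norm_eq_abs, ne_eq, OfNat.ofNat_ne_zero, not_false_eq_true, zero_pow, sub_zero,
      abs_pow, sq_abs]
    rcases max_cases 0 y with ⟨h, _⟩ | ⟨h, _⟩ <;> rw [h]
    nlinarith [sq_nonneg y]
  · have h : (fun q : ℝ => max 0 q ^ 2) =ᶠ[nhds q] fun q => q ^ 2 := by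
      filter_upwards [Ioi_mem_nhds hq] with y hy
      simp [max_eq_right (Set.mem_Ioi.1 hy).le]
    rw [max_eq_right hq.le]
    simpa using (hasDerivAt_pow 2 q).congr_of_eventuallyEq h

lemma hasFDerivAt_ballWeight_sq {d : ℕ} (x : EuclideanSpace ℝ (Fin d)) :
    HasFDerivAt (fun x => ballWeight x ^ 2)
      ((-4 * ballWeight x) • innerSL ℝ x) x := by
  have h1 : HasFDerivAt (fun x : EuclideanSpace ℝ (Fin d) => 1 - ‖x‖ ^ 2)
      (-(2 • innerSL ℝ x)) x := (hasStrictFDerivAt_norm_sq x).hasFDerivAt.const_sub 1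
  have h2 := (hasDerivAt_max_zero_sq (1 - ‖x‖ ^ 2)).comp_hasFDerivAt x h1
  refine h2.congr_fderiv ?_
  ext v
  simp [ballWeight]
  ring

/-- Green's identity with radial weight: the radial derivative is symmetric on harmonic functions. -/
lemma integral_radial_deriv_comm {d : ℕ} {f g : EuclideanSpace ℝ (Fin d) → ℝ}
    (hf : ContDiff ℝ 2 f) (hg : ContDiff ℝ 2 g)
    (hf0 : ∀ x ∈ ball (0 : EuclideanSpace ℝ (Fin d)) 1, lapR f x = 0)
    (hg0 : ∀ x ∈ ball (0 : EuclideanSpace ℝ (Fin d)) 1, lapR g x = 0) :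
    ∫ x, (fderiv ℝ f x x * g x - f x * fderiv ℝ g x x) * ballWeight x = 0 := by
  have hf1 : ∀ v, ContDiff ℝ 1 fun y => fderiv ℝ f y v := fun v =>
    (hf.fderiv_right (m := 1) (by norm_num)).clm_apply contDiff_const
  have hg1 : ∀ v, ContDiff ℝ 1 fun y => fderiv ℝ g y v := fun v =>
    (hg.fderiv_right (m := 1) (by norm_num)).clm_apply contDiff_const
  set e : Fin d → EuclideanSpace ℝ (Fin d) := fun i => EuclideanSpace.single i 1 with he
  have hfc : Continuous f := hf.continuous
  have hgc : Continuous g := hg.continuous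
  let A : Fin d → EuclideanSpace ℝ (Fin d) → ℝ := fun i y =>
    fderiv ℝ f y (e i) * g y - f y * fderiv ℝ g y (e i)
  have hA : ∀ i, ContDiff ℝ 1 (A i) := fun i =>
    ((hf1 _).mul (hg.of_le (by norm_num))).sub ((hf.of_le (by norm_num)).mul (hg1 _))
  have hA' : ∀ i, Continuous fun x => fderiv ℝ (A i) x (e i) := fun i =>
    ((hA i).continuous_fderiv (by norm_num)).clm_apply continuous_const
  have hW : ∀ i x, fderiv ℝ (fun x => ballWeight x ^ 2) x (e i) = -4 * (x i * ballWeight x) := by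
    intro i x
    rw [(hasFDerivAt_ballWeight_sq x).fderiv]
    simp [he, EuclideanSpace.inner_single_right]
    ring
  have hxc : ∀ i, Continuous fun x : EuclideanSpace ℝ (Fin d) => x i := fun i => by fun_prop
  have hint : ∀ i, Integrable fun x => A i x * x i * ballWeight x := fun i =>
    integrable_mul_ballWeight ((hA i).continuous.mul (hxc i))
  have hint' : ∀ i, Integrable fun x => fderiv ℝ (A i) x (e i) * ballWeight x ^ 2 := fun i => by
    have := integrable_mul_ballWeight ((hA' i).mul continuous_ballWeight)
    refine this.congr (Filter.Eventually.of_forall fun x => ?_)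
    simp only [Pi.mul_apply]; ring
  have hparts : ∀ i, ∫ x, A i x * x i * ballWeight x
      = 4⁻¹ * ∫ x, fderiv ℝ (A i) x (e i) * ballWeight x ^ 2 := by
    intro i
    have h := integral_mul_fderiv_eq_neg_fderiv_mul_of_integrable (μ := volume) (v := e i)
      (f := A i) (g := fun x => ballWeight x ^ 2) (hint' i) ?_ ?_
      (fun x _ => (hA i).differentiable (by norm_num) x)
      (fun x _ => (hasFDerivAt_ballWeight_sq x).differentiableAt)
    · rw [← neg_eq_iff_eq_neg] at h
      rw [← h, ← integral_neg, ← integral_const_mul]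
      congr 1
      ext x
      rw [hW]; ring
    · refine ((hint i).const_mul (-4)).congr (Filter.Eventually.of_forall fun x => ?_)
      simp only [hW]; ring
    · have := integrable_mul_ballWeight ((hA i).continuous.mul continuous_ballWeight)
      refine this.congr (Filter.Eventually.of_forall fun x => ?_)
      simp only [Pi.mul_apply]; ring
  have hsum : ∀ x, (fderiv ℝ f x x * g x - f x * fderiv ℝ g x x) * ballWeight x
      = ∑ i, A i x * x i * ballWeight x := by
    intro x
    have hx : ∀ L : EuclideanSpace ℝ (Fin d) →L[ℝ] ℝ, L x = ∑ i, x i * L (e i) := by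
      intro L
      conv_lhs => rw [← (EuclideanSpace.basisFun (Fin d) ℝ).sum_repr x]
      simp [he]
    rw [hx (fderiv ℝ f x), hx (fderiv ℝ g x), ← Finset.sum_mul, Finset.sum_mul, Finset.mul_sum,
      ← Finset.sum_sub_distrib]
    congr 1
    refine Finset.sum_congr rfl fun i _ => ?_
    simp only [A]; ring
  simp_rw [hsum]
  rw [integral_finsetSum _ fun i _ => hint i]
  simp_rw [hparts]
  rw [← Finset.mul_sum, ← integral_finsetSum _ fun i _ => hint' i]
  have hzero : ∀ x, ∑ i, fderiv ℝ (A i) x (e i) * ballWeight x ^ 2 = 0 := by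
    intro x
    rcases lt_or_ge ‖x‖ 1 with hx | hx
    · have hx' : x ∈ ball (0 : EuclideanSpace ℝ (Fin d)) 1 := by simpa using hx
      have hAi : ∀ i, fderiv ℝ (A i) x (e i) =
          fderiv ℝ (fun y => fderiv ℝ f y (e i)) x (e i) * g x
            - f x * fderiv ℝ (fun y => fderiv ℝ g y (e i)) x (e i) := by
        intro i
        have d1 := ((hf1 (e i)).differentiable (by norm_num) x).hasFDerivAt
        have d2 := ((hg1 (e i)).differentiable (by norm_num) x).hasFDerivAt
        have d3 := (hf.differentiable (by norm_num) x).hasFDerivAt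
        have d4 := (hg.differentiable (by norm_num) x).hasFDerivAt
        have := ((d1.mul d4).sub (d3.mul d2)).fderiv
        simp only [A]
        rw [show (fun y => fderiv ℝ f y (e i) * g y - f y * fderiv ℝ g y (e i)) =
          ((fun y => fderiv ℝ f y (e i)) * g - f * fun y => fderiv ℝ g y (e i)) from rfl]
        rw [this]
        simp
        ring
      have h1 := hf0 x hx'
      have h2 := hg0 x hx'
      unfold lapR at h1 h2
      rw [← Finset.sum_mul]
      simp_rw [hAi]
      rw [Finset.sum_sub_distrib, ← Finset.sum_mul, ← Finset.mul_sum, h1, h2]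
      simp
    · simp [ballWeight_eq_zero hx]
  simp_rw [hzero]
  simp

lemma hasDerivAt_integral_mul_ballWeight {d : ℕ} {K K' : ℝ → EuclideanSpace ℝ (Fin d) → ℝ}
    (hK : ∀ τ, Continuous (K τ)) (hK' : Continuous (Function.uncurry K'))
    (hd : ∀ τ x, HasDerivAt (fun τ => K τ x) (K' τ x) τ) (τ₀ : ℝ) :
    HasDerivAt (fun τ => ∫ x, K τ x * ballWeight x) (∫ x, K' τ₀ x * ballWeight x) τ₀ := by
  obtain ⟨C, hC⟩ := ((isCompact_Icc (a := τ₀ - 1) (b := τ₀ + 1)).prod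
    (isCompact_closedBall (0 : EuclideanSpace ℝ (Fin d)) 1)).exists_bound_of_continuousOn
      hK'.continuousOn
  have hK'c : ∀ τ, Continuous (K' τ) := fun τ => hK'.comp (Continuous.prodMk_right τ)
  refine (hasDerivAt_integral_of_dominated_loc_of_deriv_le (s := Set.Icc (τ₀ - 1) (τ₀ + 1))
    (F := fun τ x => K τ x * ballWeight x) (F' := fun τ x => K' τ x * ballWeight x)
    (bound := fun x => C * ballWeight x) (Icc_mem_nhds (by linarith) (by linarith))
    (Filter.Eventually.of_forall fun τ =>
      ((hK τ).mul continuous_ballWeight).aestronglyMeasurable)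
    (integrable_mul_ballWeight (hK τ₀))
    ((hK'c τ₀).mul continuous_ballWeight).aestronglyMeasurable
    (Filter.Eventually.of_forall fun x τ hτ => ?_)
    (integrable_mul_ballWeight continuous_const)
    (Filter.Eventually.of_forall fun x τ _ => (hd τ x).mul_const _)).2
  rcases le_or_gt ‖x‖ 1 with hx | hx
  · have := hC (τ, x) ⟨hτ, by simpa using hx⟩
    rw [norm_mul, Real.norm_of_nonneg (ballWeight_nonneg x)]
    exact mul_le_mul_of_nonneg_right this (ballWeight_nonneg x)
  · simp [ballWeight_eq_zero hx.le]

section Affine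

variable {d : ℕ} {f : EuclideanSpace ℝ (Fin d) → ℝ}

lemma fderiv_comp_add_smul_apply (hf : Differentiable ℝ f) (p : EuclideanSpace ℝ (Fin d)) (r : ℝ)
    (y v : EuclideanSpace ℝ (Fin d)) :
    fderiv ℝ (fun x => f (p + r • x)) y v = r * fderiv ℝ f (p + r • y) v := by
  have h1 : HasFDerivAt (fun x : EuclideanSpace ℝ (Fin d) => p + r • x)
      (r • ContinuousLinearMap.id ℝ (EuclideanSpace ℝ (Fin d))) y :=
    ((hasFDerivAt_id y).const_smul r).const_add p
  have h2 : HasFDerivAt (fun x => f (p + r • x)) _ y := (hf (p + r • y)).hasFDerivAt.comp y h1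
  rw [h2.fderiv]
  simp

lemma lapR_comp_add_smul (hf : ContDiff ℝ 2 f) (p : EuclideanSpace ℝ (Fin d)) (r : ℝ)
    (y : EuclideanSpace ℝ (Fin d)) :
    lapR (fun x => f (p + r • x)) y = r ^ 2 * lapR f (p + r • y) := by
  unfold lapR
  rw [Finset.mul_sum]
  refine Finset.sum_congr rfl fun i _ => ?_
  have hf1 : Differentiable ℝ fun y => fderiv ℝ f y (EuclideanSpace.single i 1) :=
    ((hf.fderiv_right (m := 1) (by norm_num)).clm_apply contDiff_const).differentiable
      (by norm_num)
  simp_rw [fderiv_comp_add_smul_apply (hf.differentiable (by norm_num))]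
  rw [fderiv_const_mul (by fun_prop)]
  simp only [smul_apply, smul_eq_mul]
  rw [fderiv_comp_add_smul_apply hf1]
  ring

lemma contDiff_comp_add_smul (hf : ContDiff ℝ 2 f) (p : EuclideanSpace ℝ (Fin d)) (r : ℝ) :
    ContDiff ℝ 2 fun x => f (p + r • x) := by
  fun_prop

lemma hasDerivAt_comp_add_smul (hf : ContDiff ℝ 2 f) {a : ℝ → ℝ} {a' τ : ℝ}
    (ha : HasDerivAt a a' τ) (p x : EuclideanSpace ℝ (Fin d)) :
    HasDerivAt (fun τ => f (p + a τ • x)) (a' * fderiv ℝ f (p + a τ • x) x) τ := by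
  have h1 : HasDerivAt (fun τ => p + a τ • x) (a' • x) τ := (ha.smul_const x).const_add p
  have : HasDerivAt (fun τ => f (p + a τ • x)) _ τ :=
    ((hf.differentiable (by norm_num)) (p + a τ • x)).hasFDerivAt.comp_hasDerivAt τ h1
  simpa using this

/-- For harmonic functions, the weighted pairing of the dilates by `a` and `b` depends only on
`a * b`. -/
lemma integral_dilate_mul_dilate {g : EuclideanSpace ℝ (Fin d) → ℝ} {R : ℝ}
    (hf : ContDiff ℝ 2 f) (hg : ContDiff ℝ 2 g)
    (hf0 : ∀ x ∈ ball (0 : EuclideanSpace ℝ (Fin d)) R, lapR f x = 0)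
    (hg0 : ∀ x ∈ ball (0 : EuclideanSpace ℝ (Fin d)) R, lapR g x = 0)
    {a b c : ℝ} (ha : 0 < a) (hc : 0 < c) (haR : a ≤ R) (hbR : b ≤ R)
    (habc : a * b = c ^ 2) :
    ∫ x, f (a • x) * g (b • x) * ballWeight x = ∫ x, f (c • x) * g (c • x) * ballWeight x := by
  have hR : 0 < R := ha.trans_le haR
  have hcR : c ≤ R := by nlinarith
  let φ : ℝ → ℝ := fun τ =>
    ∫ x, f (0 + (c * Real.exp τ) • x) * g (0 + (c * Real.exp (-τ)) • x) * ballWeight x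
  have hlap : ∀ {h : EuclideanSpace ℝ (Fin d) → ℝ}, ContDiff ℝ 2 h →
      (∀ x ∈ ball (0 : EuclideanSpace ℝ (Fin d)) R, lapR h x = 0) → ∀ r, 0 < r → r ≤ R →
      ∀ x ∈ ball (0 : EuclideanSpace ℝ (Fin d)) 1, lapR (fun x => h (0 + r • x)) x = 0 := by
    intro h hh hh0 r hr hrR x hx
    rw [lapR_comp_add_smul hh, hh0, mul_zero]
    rw [mem_ball_zero_iff] at hx ⊢
    rw [zero_add, norm_smul, Real.norm_of_nonneg hr.le]
    nlinarith [norm_nonneg x]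
  have hE : ∀ τ, HasDerivAt (fun τ => c * Real.exp τ) (c * Real.exp τ) τ := fun τ =>
    (Real.hasDerivAt_exp τ).const_mul c
  have hE' : ∀ τ, HasDerivAt (fun τ => c * Real.exp (-τ)) (-(c * Real.exp (-τ))) τ := fun τ => by
    simpa using ((Real.hasDerivAt_exp (-τ)).comp τ (hasDerivAt_neg τ)).const_mul c
  have hfc : Continuous f := hf.continuous
  have hgc : Continuous g := hg.continuous
  have hf' : Continuous (fderiv ℝ f) := hf.continuous_fderiv (by norm_num)
  have hg' : Continuous (fderiv ℝ g) := hg.continuous_fderiv (by norm_num)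
  have hφ : ∀ τ, c * Real.exp τ ≤ R → c * Real.exp (-τ) ≤ R → HasDerivAt φ 0 τ := by
    intro τ h1 h2
    have hd := hasDerivAt_integral_mul_ballWeight
      (K := fun τ x => f (0 + (c * Real.exp τ) • x) * g (0 + (c * Real.exp (-τ)) • x))
      (K' := fun τ x => (c * Real.exp τ * fderiv ℝ f (0 + (c * Real.exp τ) • x) x) *
          g (0 + (c * Real.exp (-τ)) • x) + f (0 + (c * Real.exp τ) • x) *
          (-(c * Real.exp (-τ)) * fderiv ℝ g (0 + (c * Real.exp (-τ)) • x) x))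
      (fun τ => by fun_prop) (by unfold Function.uncurry; fun_prop)
      (fun τ x => (hasDerivAt_comp_add_smul hf (hE τ) 0 x).mul
        (hasDerivAt_comp_add_smul hg (hE' τ) 0 x)) τ
    have h0 := integral_radial_deriv_comm (contDiff_comp_add_smul hf 0 (c * Real.exp τ))
      (contDiff_comp_add_smul hg 0 (c * Real.exp (-τ)))
      (hlap hf hf0 _ (by positivity) h1) (hlap hg hg0 _ (by positivity) h2)
    convert hd using 1
    rw [← h0]
    congr 1
    ext x
    rw [fderiv_comp_add_smul_apply (hf.differentiable (by norm_num)),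
      fderiv_comp_add_smul_apply (hg.differentiable (by norm_num))]
    ring
  set T := Real.log (R / c) with hT
  have hTexp : c * Real.exp T = R := by
    rw [hT, Real.exp_log (by positivity)]; field_simp
  have hT0 : 0 ≤ T := Real.log_nonneg ((one_le_div hc).2 hcR)
  have hle : ∀ σ ≤ T, c * Real.exp σ ≤ R := fun σ hσ => by
    rw [← hTexp]; gcongr
  have hder : ∀ τ ∈ Set.Icc (-T) T, HasDerivAt φ 0 τ := fun τ hτ =>
    hφ τ (hle _ hτ.2) (hle _ (by linarith [hτ.1]))
  have hconst := constant_of_has_deriv_right_zero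
    (fun τ hτ => (hder τ hτ).continuousAt.continuousWithinAt)
    (fun τ hτ => (hder τ (Set.Ico_subset_Icc_self hτ)).hasDerivWithinAt)
  set τ₁ := Real.log (a / c) with hτ₁
  have e1 : c * Real.exp τ₁ = a := by
    rw [hτ₁, Real.exp_log (by positivity)]; field_simp
  have e2 : c * Real.exp (-τ₁) = b := by
    rw [hτ₁, ← Real.log_inv, Real.exp_log (by positivity)]
    field_simp; linarith
  have m1 : τ₁ ≤ T := Real.log_le_log (by positivity) (by gcongr)
  have m2 : -T ≤ τ₁ := by
    rw [neg_le, hτ₁, ← Real.log_inv]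
    refine Real.log_le_log (by positivity) ?_
    rw [inv_div, div_le_div_iff₀ ha hc]
    nlinarith
  have key := (hconst τ₁ ⟨m2, m1⟩).trans (hconst 0 ⟨by linarith, hT0⟩).symm
  simpa [φ, e1, e2] using key

/-- The mean value property with respect to the radial weight. -/
lemma integral_dilate_eq {R : ℝ} (hf : ContDiff ℝ 2 f) {p : EuclideanSpace ℝ (Fin d)}
    (hf0 : ∀ x ∈ ball p R, lapR f x = 0) (hR : 0 ≤ R) :
    ∫ x, f (p + R • x) * ballWeight x =
      f p * ∫ x : EuclideanSpace ℝ (Fin d), ballWeight x := by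
  have hfc : Continuous f := hf.continuous
  have hf' : Continuous (fderiv ℝ f) := hf.continuous_fderiv (by norm_num)
  have hfd : Differentiable ℝ f := hf.differentiable (by norm_num)
  have hone : ∀ x : EuclideanSpace ℝ (Fin d), lapR (fun _ => (1 : ℝ)) x = 0 := by simp [lapR]
  let φ : ℝ → ℝ := fun τ => ∫ x, f (p + τ • x) * ballWeight x
  have hder : ∀ τ ∈ Set.Icc 0 R, HasDerivAt φ 0 τ := by
    intro τ hτ
    have hd := hasDerivAt_integral_mul_ballWeight
      (K := fun τ x => f (p + τ • x)) (K' := fun τ x => 1 * fderiv ℝ f (p + τ • x) x)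
      (fun τ => by fun_prop) (by unfold Function.uncurry; fun_prop)
      (fun τ x => hasDerivAt_comp_add_smul hf (hasDerivAt_id τ) p x) τ
    convert hd using 1
    rcases hτ.1.eq_or_lt with h | h
    · have h0 := integral_radial_deriv_comm (f := fun x => fderiv ℝ f p x) (g := fun _ => 1)
        (fderiv ℝ f p).contDiff contDiff_const (by simp [lapR]) (fun x _ => hone x)
      simpa [← h] using h0.symm
    · have h0 := integral_radial_deriv_comm (g := fun _ => 1) (contDiff_comp_add_smul hf p τ)
        contDiff_const (fun x hx => by
          rw [lapR_comp_add_smul hf, hf0, mul_zero]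
          rw [mem_ball_zero_iff] at hx
          rw [mem_ball_iff_norm, add_sub_cancel_left, norm_smul, Real.norm_of_nonneg h.le]
          nlinarith [norm_nonneg x, hτ.2]) (fun x _ => hone x)
      simp only [fderiv_comp_add_smul_apply hfd, mul_one, fderiv_fun_const, Pi.zero_apply,
        _root_.zero_apply, mul_zero, sub_zero, mul_assoc] at h0
      rw [integral_const_mul] at h0
      simp only [one_mul]
      exact ((mul_eq_zero.1 h0).resolve_left h.ne').symm
  have hconst := constant_of_has_deriv_right_zero
    (fun τ hτ => (hder τ hτ).continuousAt.continuousWithinAt)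
    (fun τ hτ => (hder τ (Set.Ico_subset_Icc_self hτ)).hasDerivWithinAt) R ⟨hR, le_rfl⟩
  simpa [φ, integral_const_mul] using hconst

end Affine

/-- Cauchy–Schwarz inequality for the radial weight. -/
lemma sq_integral_mul_ballWeight_le {d : ℕ} {f g : EuclideanSpace ℝ (Fin d) → ℝ}
    (hf : Continuous f) (hg : Continuous g) :
    (∫ x, f x * g x * ballWeight x) ^ 2 ≤
      (∫ x, f x ^ 2 * ballWeight x) * ∫ x, g x ^ 2 * ballWeight x := by
  have h1 := integrable_mul_ballWeight (hf.pow 2)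
  have h2 := integrable_mul_ballWeight (hf.mul hg)
  have h3 := integrable_mul_ballWeight (hg.pow 2)
  have key : ∀ t : ℝ, 0 ≤ (∫ x, g x ^ 2 * ballWeight x) * (t * t) +
      (2 * ∫ x, f x * g x * ballWeight x) * t + ∫ x, f x ^ 2 * ballWeight x := by
    intro t
    have : (∫ x, g x ^ 2 * ballWeight x) * (t * t) +
      (2 * ∫ x, f x * g x * ballWeight x) * t + ∫ x, f x ^ 2 * ballWeight x =
        ∫ x, (f x + t * g x) ^ 2 * ballWeight x := by
      simp only [Pi.mul_apply, Pi.pow_apply] at h1 h2 h3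
      rw [mul_comm _ (t * t), mul_comm (2 * _) t, ← integral_const_mul, ← integral_const_mul 2,
        ← integral_const_mul t, ← integral_add, ← integral_add]
      · congr 1; ext x; ring
      · exact (h3.const_mul _).add ((h2.const_mul 2).const_mul t)
      · exact h1
      · exact h3.const_mul _
      · exact (h2.const_mul 2).const_mul t
    rw [this]
    exact integral_nonneg fun x => mul_nonneg (sq_nonneg _) (ballWeight_nonneg x)
  have := discrim_le_zero key
  unfold discrim at this
  nlinarith

/-- Interior estimate for harmonic functions in terms of the weighted `L²` norm on a larger ball. -/
lemma sq_mul_integral_ballWeight_le {d : ℕ} {f : EuclideanSpace ℝ (Fin d) → ℝ} {R r s : ℝ}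
    (hf : ContDiff ℝ 2 f) (hf0 : ∀ x ∈ ball (0 : EuclideanSpace ℝ (Fin d)) R, lapR f x = 0)
    {x : EuclideanSpace ℝ (Fin d)} (hx : ‖x‖ ≤ s) (hsr : s < r) (hrR : r ≤ R) :
    f x ^ 2 * ∫ x : EuclideanSpace ℝ (Fin d), ballWeight x ≤
      (2 / (1 - s / r)) ^ (d + 1) * ∫ x, f (r • x) ^ 2 * ballWeight x := by
  have hs : 0 ≤ s := (norm_nonneg x).trans hx
  have hr : 0 < r := hs.trans_lt hsr
  have hfc : Continuous f := hf.continuous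
  set I := ∫ x : EuclideanSpace ℝ (Fin d), ballWeight x with hI
  have hIpos : 0 < I := integral_ballWeight_pos
  set ρ := (r - s) / 2 with hρ
  have hρpos : 0 < ρ := by linarith
  set D := 2 / (1 - s / r) with hD
  have hδ : 0 < 1 - s / r := by rw [sub_pos, div_lt_one hr]; exact hsr
  have hDρ : r / ρ = D := by
    have : r - s ≠ 0 := by linarith
    rw [hD, hρ]; field_simp
  have hDpos : 0 < D := by positivity
  have hmean := integral_dilate_eq hf (p := x) (R := ρ) (fun y hy => hf0 y (by
    rw [mem_ball_zero_iff]
    rw [mem_ball_iff_norm] at hy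
    have := norm_le_norm_add_norm_sub x y
    rw [norm_sub_rev] at hy
    linarith)) hρpos.le
  have hcs := sq_integral_mul_ballWeight_le (f := fun y => f (x + ρ • y)) (g := fun _ => 1)
    (by fun_prop) continuous_const
  simp only [mul_one, one_pow, one_mul] at hcs
  rw [hmean, ← hI] at hcs
  have h1 : f x ^ 2 * I ≤ ∫ y, f (x + ρ • y) ^ 2 * ballWeight y := by
    rw [mul_pow, sq I, ← mul_assoc] at hcs
    exact le_of_mul_le_mul_right hcs hIpos
  refine h1.trans ?_
  let G : EuclideanSpace ℝ (Fin d) → ℝ := fun y =>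
    f (x + ρ • (y - ρ⁻¹ • x)) ^ 2 * ballWeight (y - ρ⁻¹ • x)
  have h2 : ∫ y, f (x + ρ • y) ^ 2 * ballWeight y = ∫ y, G y :=
    (integral_sub_right_eq_self (fun y => f (x + ρ • y) ^ 2 * ballWeight y) (ρ⁻¹ • x)).symm
  have h3 : ∫ y, G y = D ^ d * ∫ z, G (D • z) := by
    rw [Measure.integral_comp_smul, abs_of_pos (by positivity)]
    simp [hDpos.ne']
  have hpt : ∀ z, G (D • z) ≤ D * (f (r • z) ^ 2 * ballWeight z) := by
    intro z
    have e : x + ρ • (D • z - ρ⁻¹ • x) = r • z := by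
      rw [smul_sub, smul_smul, smul_smul, mul_inv_cancel₀ hρpos.ne', ← hDρ,
        mul_div_cancel₀ _ hρpos.ne', one_smul, add_sub_cancel]
    simp only [G]
    rw [e, mul_left_comm]
    refine mul_le_mul_of_nonneg_left ?_ (sq_nonneg _)
    rcases le_or_gt 1 ‖D • z - ρ⁻¹ • x‖ with h | h
    · rw [ballWeight_eq_zero h]
      exact mul_nonneg hDpos.le (ballWeight_nonneg z)
    · have hw : ballWeight (D • z - ρ⁻¹ • x) ≤ 1 :=
        max_le zero_le_one (by linarith [sq_nonneg ‖D • z - ρ⁻¹ • x‖])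
      have hz : r * ‖z‖ < (r + s) / 2 := by
        have h4 : ‖r • z‖ ≤ ‖x‖ + ρ * ‖D • z - ρ⁻¹ • x‖ := by
          rw [← e]
          refine (norm_add_le _ _).trans ?_
          rw [norm_smul ρ, Real.norm_of_nonneg hρpos.le]
        rw [norm_smul, Real.norm_of_nonneg hr.le] at h4
        nlinarith
      have hz' : ‖z‖ < 1 - (1 - s / r) / 2 := by
        have : 1 - (1 - s / r) / 2 = (r + s) / 2 / r := by field_simp; ring
        rw [this, lt_div_iff₀ hr]
        linarith
      have hwz : (1 - s / r) / 2 ≤ ballWeight z :=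
        le_max_of_le_right (by nlinarith [norm_nonneg z])
      calc ballWeight (D • z - ρ⁻¹ • x) ≤ 1 := hw
        _ = D * ((1 - s / r) / 2) := by rw [hD, div_mul_div_cancel₀' two_ne_zero, div_self hδ.ne']
        _ ≤ D * ballWeight z := mul_le_mul_of_nonneg_left hwz hDpos.le
  rw [h2, h3, pow_succ, mul_assoc]
  refine mul_le_mul_of_nonneg_left ?_ (by positivity)
  rw [← integral_const_mul]
  refine integral_mono_of_nonneg (Filter.Eventually.of_forall fun z =>
    mul_nonneg (sq_nonneg _) (ballWeight_nonneg _)) ?_ (Filter.Eventually.of_forall hpt)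
  exact (integrable_mul_ballWeight (f := fun z => f (r • z) ^ 2) (by fun_prop)).const_mul D

lemma sq_mul_rpow_half_pow_succ {x y : ℝ} (hx : 0 ≤ x) (hy : 0 < y) (j : ℕ) :
    (y * (x / y) ^ ((1 / 2 : ℝ) ^ (j + 1))) ^ 2 = y * (x / y) ^ ((1 / 2 : ℝ) ^ j) * y := by
  have : ((x / y) ^ ((1 / 2 : ℝ) ^ (j + 1))) ^ 2 = (x / y) ^ ((1 / 2 : ℝ) ^ j) := by
    rw [← Real.rpow_natCast, ← Real.rpow_mul (by positivity)]
    congr 1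
    push_cast
    ring
  rw [mul_pow, this]
  ring

/-- Logarithmic convexity of the weighted `L²` norms of a harmonic function. -/
lemma integral_sq_dilate_le {d : ℕ} {f : EuclideanSpace ℝ (Fin d) → ℝ} {R a b A B : ℝ}
    (hf : ContDiff ℝ 2 f) (hf0 : ∀ x ∈ ball (0 : EuclideanSpace ℝ (Fin d)) R, lapR f x = 0)
    (ha : 0 < a) (hab : a ≤ b) (hbR : b ≤ R) (hA : 0 ≤ A) (hB : 0 < B)
    (hAf : ∀ x ∈ ball (0 : EuclideanSpace ℝ (Fin d)) a, |f x| ≤ A)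
    (hBf : ∀ x ∈ ball (0 : EuclideanSpace ℝ (Fin d)) b, |f x| ≤ B) (j : ℕ) :
    ∫ x, f ((b * (a / b) ^ ((1 / 2 : ℝ) ^ j)) • x) ^ 2 * ballWeight x ≤
      (B * (A / B) ^ ((1 / 2 : ℝ) ^ j)) ^ 2 *
        ∫ x : EuclideanSpace ℝ (Fin d), ballWeight x := by
  have hfc : Continuous f := hf.continuous
  have hb : 0 < b := ha.trans_le hab
  have hbound : ∀ r M, 0 < r → (∀ x ∈ ball (0 : EuclideanSpace ℝ (Fin d)) r, |f x| ≤ M) →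
      ∫ x, f (r • x) ^ 2 * ballWeight x ≤
        M ^ 2 * ∫ x : EuclideanSpace ℝ (Fin d), ballWeight x := by
    intro r M hr hM
    rw [← integral_const_mul]
    refine integral_mono (integrable_mul_ballWeight (f := fun x => f (r • x) ^ 2) (by fun_prop))
      (integrable_mul_ballWeight continuous_const) fun x => ?_
    rcases le_or_gt 1 ‖x‖ with h | h
    · simp [ballWeight_eq_zero h]
    · refine mul_le_mul_of_nonneg_right ?_ (ballWeight_nonneg x)
      rw [sq_le_sq]
      refine (hM _ ?_).trans (le_abs_self M)
      rw [mem_ball_zero_iff, norm_smul, Real.norm_of_nonneg hr.le]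
      nlinarith
  induction j with
  | zero =>
    simp only [pow_zero, Real.rpow_one, mul_div_cancel₀ _ hb.ne', mul_div_cancel₀ _ hB.ne']
    exact hbound a A ha hAf
  | succ j ih =>
    have hpos : ∀ i : ℕ, 0 < b * (a / b) ^ ((1 / 2 : ℝ) ^ i) := fun i => by positivity
    have hle : b * (a / b) ^ ((1 / 2 : ℝ) ^ j) ≤ b :=
      mul_le_of_le_one_right hb.le
        (Real.rpow_le_one (by positivity) ((div_le_one hb).2 hab) (by positivity))
    have hpair := integral_dilate_mul_dilate hf hf hf0 hf0 (hpos j) (hpos (j + 1))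
      (hle.trans hbR) hbR (sq_mul_rpow_half_pow_succ ha.le hb j).symm
    have hcs := sq_integral_mul_ballWeight_le
      (f := fun x => f ((b * (a / b) ^ ((1 / 2 : ℝ) ^ j)) • x)) (g := fun x => f (b • x))
      (by fun_prop) (by fun_prop)
    rw [hpair] at hcs
    simp only [← sq] at hcs
    rw [sq_mul_rpow_half_pow_succ hA hB j]
    have hI : 0 < ∫ x : EuclideanSpace ℝ (Fin d), ballWeight x := integral_ballWeight_pos
    set I := ∫ x : EuclideanSpace ℝ (Fin d), ballWeight x
    set X := B * (A / B) ^ ((1 / 2 : ℝ) ^ j)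
    have hX : 0 ≤ X := by positivity
    refine le_of_sq_le_sq ?_ (by positivity)
    calc _ ≤ _ := hcs
      _ ≤ (X ^ 2 * I) * (B ^ 2 * I) :=
        mul_le_mul ih (hbound b B hb hBf)
          (integral_nonneg fun x => mul_nonneg (sq_nonneg _) (ballWeight_nonneg x))
          (by positivity)
      _ = _ := by ring

/-- Three-balls inequality for harmonic functions. -/
lemma abs_le_of_harmonic {d : ℕ} {f : EuclideanSpace ℝ (Fin d) → ℝ} {R a s t b A B γ : ℝ}
    (hf : ContDiff ℝ 2 f) (hf0 : ∀ x ∈ ball (0 : EuclideanSpace ℝ (Fin d)) R, lapR f x = 0)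
    (ha : 0 < a) (hat : a < t) (hst : s < t) (htb : t < b) (hbR : b ≤ R)
    (hA : 0 ≤ A) (hB : 0 < B) (hAB : A ≤ B)
    (hAf : ∀ x ∈ ball (0 : EuclideanSpace ℝ (Fin d)) a, |f x| ≤ A)
    (hBf : ∀ x ∈ ball (0 : EuclideanSpace ℝ (Fin d)) b, |f x| ≤ B)
    (hγ : 0 ≤ γ) (hγ' : γ ≤ Real.log (b / t) / Real.log (b / a) / 2)
    {x : EuclideanSpace ℝ (Fin d)} (hx : ‖x‖ ≤ s) :
    f x ^ 2 ≤ (2 / (1 - s / t)) ^ (d + 1) * (B * (A / B) ^ γ) ^ 2 := by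
  have hs : 0 ≤ s := (norm_nonneg x).trans hx
  have ht : 0 < t := ha.trans hat
  have hb : 0 < b := ht.trans htb
  have hlog : 0 < Real.log (b / a) := Real.log_pos ((one_lt_div ha).2 (hat.trans htb))
  have hlogt : 0 < Real.log (b / t) := Real.log_pos ((one_lt_div ht).2 htb)
  have hlogle : Real.log (b / t) ≤ Real.log (b / a) :=
    Real.log_le_log (by positivity) (by gcongr)
  obtain ⟨n, hn1, hn2⟩ := exists_nat_pow_near_of_lt_one (y := (1 / 2 : ℝ)) (div_pos hlogt hlog)
    ((div_le_one hlog).2 hlogle) (by norm_num) (by norm_num)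
  set r := b * (a / b) ^ ((1 / 2 : ℝ) ^ (n + 1)) with hr
  have hrb : r ≤ b := mul_le_of_le_one_right hb.le
        (Real.rpow_le_one (by positivity) ((div_le_one hb).2 (hat.trans htb).le) (by positivity))
  have hrpos : 0 < r := by positivity
  have htr : t ≤ r := by
    rw [← Real.log_le_log_iff ht hrpos, hr, Real.log_mul hb.ne' (by positivity),
      Real.log_rpow (by positivity)]
    rw [lt_div_iff₀ hlog] at hn1
    rw [Real.log_div hb.ne' ht.ne', Real.log_div hb.ne' ha.ne'] at hn1
    rw [Real.log_div ha.ne' hb.ne']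
    linarith
  have h1 := sq_mul_integral_ballWeight_le hf hf0 hx (hst.trans_le htr) (hrb.trans hbR)
  have h2 := integral_sq_dilate_le hf hf0 ha (hat.trans htb).le hbR hA hB hAf hBf (n + 1)
  have hI : 0 < ∫ x : EuclideanSpace ℝ (Fin d), ballWeight x := integral_ballWeight_pos
  refine le_of_mul_le_mul_right (h1.trans ?_) hI
  have hδ : 0 < 1 - s / t := by rw [sub_pos, div_lt_one ht]; exact hst
  have hδ' : 1 - s / t ≤ 1 - s / r := by gcongr
  have hδr : 0 < 1 - s / r := hδ.trans_le hδ'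
  rw [mul_assoc]
  refine mul_le_mul (by gcongr) (h2.trans ?_)
    (integral_nonneg fun x => mul_nonneg (sq_nonneg _) (ballWeight_nonneg x)) (by positivity)
  have hexp : γ ≤ (1 / 2 : ℝ) ^ (n + 1) := by rw [pow_succ]; linarith
  have : (A / B) ^ ((1 / 2 : ℝ) ^ (n + 1)) ≤ (A / B) ^ γ :=
    Real.rpow_le_rpow_of_exponent_ge' (by positivity) ((div_le_one hB).2 hAB) hγ hexp
  gcongr

/-- The projection `ℝ^{N+1} → ℝ^N` forgetting the last coordinate. -/
noncomputable def initL (N : ℕ) : EuclideanSpace ℝ (Fin (N + 1)) →L[ℝ] EuclideanSpace ℝ (Fin N) :=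
  (EuclideanSpace.equiv (Fin N) ℝ).symm.toContinuousLinearMap ∘L
    ContinuousLinearMap.pi fun i => EuclideanSpace.proj i.castSucc

lemma initL_apply {N : ℕ} (z : EuclideanSpace ℝ (Fin (N + 1))) (i : Fin N) :
    initL N z i = z i.castSucc := by
  simp [initL]

lemma norm_sq_eq_initL {N : ℕ} (z : EuclideanSpace ℝ (Fin (N + 1))) :
    ‖z‖ ^ 2 = ‖initL N z‖ ^ 2 + z (Fin.last N) ^ 2 := by
  rw [EuclideanSpace.real_norm_sq_eq, EuclideanSpace.real_norm_sq_eq, Fin.sum_univ_castSucc]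
  simp [initL_apply]

lemma norm_initL_le {N : ℕ} (z : EuclideanSpace ℝ (Fin (N + 1))) : ‖initL N z‖ ≤ ‖z‖ := by
  have := norm_sq_eq_initL z
  nlinarith [norm_nonneg z, norm_nonneg (initL N z), sq_nonneg (z (Fin.last N))]

lemma last_le_norm {N : ℕ} (z : EuclideanSpace ℝ (Fin (N + 1))) : z (Fin.last N) ≤ ‖z‖ := by
  have := norm_sq_eq_initL z
  nlinarith [norm_nonneg z, sq_nonneg ‖initL N z‖]

lemma initL_single_castSucc {N : ℕ} (i : Fin N) :
    initL N (EuclideanSpace.single i.castSucc 1) = EuclideanSpace.single i 1 := by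
  ext j
  rw [initL_apply]
  simp

lemma initL_single_last {N : ℕ} :
    initL N (EuclideanSpace.single (Fin.last N) 1) = 0 := by
  ext j
  rw [initL_apply]
  simp

/-- A solution `f` of the Helmholtz equation gives the harmonic function `f(x) exp(k y)`. -/
noncomputable def harmonicExt {N : ℕ} (k : ℝ) (f : EuclideanSpace ℝ (Fin N) → ℝ)
    (z : EuclideanSpace ℝ (Fin (N + 1))) : ℝ :=
  f (initL N z) * Real.exp (k * z (Fin.last N))

lemma contDiff_harmonicExt {N : ℕ} (k : ℝ) {f : EuclideanSpace ℝ (Fin N) → ℝ} {n : WithTop ℕ∞}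
    (hf : ContDiff ℝ n f) : ContDiff ℝ n (harmonicExt k f) := by
  unfold harmonicExt
  fun_prop

lemma fderiv_harmonicExt {N : ℕ} (k : ℝ) {f : EuclideanSpace ℝ (Fin N) → ℝ}
    (hf : Differentiable ℝ f) (z v : EuclideanSpace ℝ (Fin (N + 1))) :
    fderiv ℝ (harmonicExt k f) z v =
      harmonicExt k (fun x => fderiv ℝ f x (initL N v)) z +
        k * v (Fin.last N) * harmonicExt k f z := by
  have h1 : HasFDerivAt (fun z => f (initL N z)) _ z :=
    (hf (initL N z)).hasFDerivAt.comp z (initL N).hasFDerivAt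
  have h2 : HasFDerivAt (fun z : EuclideanSpace ℝ (Fin (N + 1)) => k * z (Fin.last N))
      (k • EuclideanSpace.proj (𝕜 := ℝ) (Fin.last N)) z :=
    (EuclideanSpace.proj (𝕜 := ℝ) (Fin.last N)).hasFDerivAt.const_mul k
  have h3 : HasFDerivAt (harmonicExt k f) _ z := h1.mul h2.exp
  rw [h3.fderiv]
  simp [harmonicExt]
  ring

lemma lapR_harmonicExt {N : ℕ} (k : ℝ) {f : EuclideanSpace ℝ (Fin N) → ℝ}
    (hf : ContDiff ℝ 2 f) (z : EuclideanSpace ℝ (Fin (N + 1))) :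
    lapR (harmonicExt k f) z =
      (lapR f (initL N z) + k ^ 2 * f (initL N z)) * Real.exp (k * z (Fin.last N)) := by
  have hfd : Differentiable ℝ f := hf.differentiable (by norm_num)
  have hf1 : ∀ v, Differentiable ℝ fun y => fderiv ℝ f y v := fun v =>
    ((hf.fderiv_right (m := 1) (by norm_num)).clm_apply contDiff_const).differentiable
      (by norm_num)
  have hd : Differentiable ℝ (harmonicExt k f) :=
    (contDiff_harmonicExt k hf).differentiable (by norm_num)
  unfold lapR
  rw [Fin.sum_univ_castSucc]
  simp_rw [fderiv_harmonicExt k hfd, initL_single_castSucc, initL_single_last]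
  have h0 : ∀ i : Fin N, (EuclideanSpace.single i.castSucc (1 : ℝ)) (Fin.last N) = 0 := by
    intro i; simp
  have h1 : (EuclideanSpace.single (Fin.last N) (1 : ℝ)) (Fin.last N) = 1 := by simp
  have h2 : (fun y => harmonicExt k (fun x => fderiv ℝ f x 0) y + k * 1 * harmonicExt k f y) =
      fun y => k * harmonicExt k f y := by
    ext y; simp [harmonicExt]
  simp_rw [h0, h1, h2, mul_zero, zero_mul, add_zero]
  rw [fderiv_const_mul hd.differentiableAt]
  simp_rw [fderiv_harmonicExt k (hf1 _), initL_single_castSucc, h0]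
  simp only [smul_apply, smul_eq_mul]
  rw [fderiv_harmonicExt k hfd, initL_single_last, h1]
  simp only [harmonicExt, map_zero, zero_mul, mul_zero, mul_one, zero_add, add_zero]
  rw [← Finset.sum_mul]
  ring

lemma lapR_comp_of_eventuallyEq {N : ℕ} {u : EuclideanSpace ℝ (Fin N) → ℂ}
    {f : EuclideanSpace ℝ (Fin N) → ℝ} (L : ℂ →L[ℝ] ℝ) {x : EuclideanSpace ℝ (Fin N)}
    (hu : ContDiffAt ℝ 2 u x) (hfu : f =ᶠ[nhds x] fun y => L (u y)) :
    lapR f x = L (lapC u x) := by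
  have hev : ∀ᶠ y in nhds x, ContDiffAt ℝ 2 u y := hu.eventually (by simp)
  have hu1 : ∀ v, DifferentiableAt ℝ (fun y => fderiv ℝ u y v) x := fun v =>
    ((hu.fderiv_right (m := 1) (by norm_num)).clm_apply contDiffAt_const).differentiableAt
      (by norm_num)
  unfold lapR lapC pdc
  rw [map_sum]
  refine Finset.sum_congr rfl fun i _ => ?_
  have h1 : (fun y => fderiv ℝ f y (EuclideanSpace.single i 1)) =ᶠ[nhds x]
      fun y => L (fderiv ℝ u y (EuclideanSpace.single i 1)) := by
    filter_upwards [hev, hfu.eventuallyEq_nhds] with y hy hy'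
    have h : HasFDerivAt (fun y => L (u y)) _ y :=
      L.hasFDerivAt.comp y (hy.differentiableAt (by norm_num)).hasFDerivAt
    rw [hy'.fderiv_eq, h.fderiv]
    rfl
  have h : HasFDerivAt (fun y => L (fderiv ℝ u y (EuclideanSpace.single i 1))) _ x :=
    L.hasFDerivAt.comp x (hu1 _).hasFDerivAt
  rw [h1.fderiv_eq, h.fderiv]
  rfl

/-- A function smooth on a ball agrees on a smaller ball with a globally smooth function. -/
lemma exists_contDiff_eq_on_ball {N : ℕ} {g : EuclideanSpace ℝ (Fin N) → ℝ} {b c : ℝ}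
    (hb : 0 < b) (hbc : b < c) (hg : ContDiffOn ℝ 2 g (ball 0 c)) :
    ∃ f : EuclideanSpace ℝ (Fin N) → ℝ, ContDiff ℝ 2 f ∧ ∀ x ∈ ball 0 b, f x = g x := by
  let χ : ContDiffBump (0 : EuclideanSpace ℝ (Fin N)) :=
    { rIn := b, rOut := (b + c) / 2, rIn_pos := hb, rIn_lt_rOut := by linarith }
  refine ⟨fun x => χ x * g x, contDiff_iff_contDiffAt.2 fun x => ?_, fun x hx => ?_⟩
  · by_cases hx' : x ∈ tsupport χ
    swap
    · refine contDiffAt_const (c := (0 : ℝ)).congr_of_eventuallyEq ?_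
      filter_upwards [notMem_tsupport_iff_eventuallyEq.1 hx'] with y hy
      simp [hy]
    rw [χ.tsupport_eq, mem_closedBall] at hx'
    have hxc : x ∈ ball (0 : EuclideanSpace ℝ (Fin N)) c := by
      rw [mem_ball]
      refine hx'.trans_lt ?_
      change (b + c) / 2 < c
      linarith
    exact χ.contDiff.contDiffAt.mul (hg.contDiffAt (isOpen_ball.mem_nhds hxc))
  · change χ x * g x = g x
    rw [χ.one_of_mem_closedBall (ball_subset_closedBall hx), one_mul]

/-- Three-balls inequality for the Helmholtz equation with real bounds. -/
lemma norm_le_of_helmholtz {N : ℕ} {k s₁ s t s₂ A B : ℝ} (hk : 0 < k)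
    {u : EuclideanSpace ℝ (Fin N) → ℂ} (hs₁ : 0 < s₁) (hs₁t : s₁ < t) (hst : s < t)
    (hts₂ : t < s₂) (hs₂ : s₂ ≤ 1) (hu : ContDiffOn ℝ 2 u (ball 0 s₂))
    (hu0 : ∀ x ∈ ball (0 : EuclideanSpace ℝ (Fin N)) s₂, lapC u x + (k : ℂ) ^ 2 * u x = 0)
    (hA : 0 ≤ A) (hB : 0 < B) (hAB : A ≤ B)
    (hAu : ∀ x ∈ ball (0 : EuclideanSpace ℝ (Fin N)) s₁, ‖u x‖ ≤ A)
    (hBu : ∀ x ∈ ball (0 : EuclideanSpace ℝ (Fin N)) s₂, ‖u x‖ ≤ B)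
    {x : EuclideanSpace ℝ (Fin N)} (hx : x ∈ ball (0 : EuclideanSpace ℝ (Fin N)) s) :
    ‖u x‖ ≤ Real.exp k * (2 / (1 - s / t)) ^ ((N : ℝ) / 2) *
      (B * (A / B) ^ ((N : ℝ) / (4 * (N + 2)) * Real.log (s₂ / t) / Real.log (s₂ / s₁))) := by
  have ht : 0 < t := hs₁.trans hs₁t
  have hs₂0 : 0 < s₂ := ht.trans hts₂
  have hE : 1 ≤ Real.exp k := Real.one_le_exp hk.le
  have hE0 : 0 < Real.exp k := Real.exp_pos k
  have hδ : 0 < 1 - s / t := by rw [sub_pos, div_lt_one ht]; exact hst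
  obtain ⟨c, hc, hcu⟩ : ∃ c : ℂ, ‖c‖ = 1 ∧ c * u x = ‖u x‖ := by
    obtain ⟨c, hc, h⟩ := RCLike.exists_norm_eq_mul_self (u x)
    exact ⟨c, hc, by simpa using h.symm⟩
  let L : ℂ →L[ℝ] ℝ := Complex.reCLM ∘L (ContinuousLinearMap.mul ℝ ℂ c)
  have hL : ∀ w, L w = (c * w).re := fun w => rfl
  have hLle : ∀ w, |L w| ≤ ‖w‖ := fun w => by
    rw [hL]; simpa [hc] using Complex.abs_re_le_norm (c * w)
  set b := Real.sqrt (s₂ * t) with hb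
  have hbsq : b ^ 2 = s₂ * t := Real.sq_sqrt (by positivity)
  have hb0 : 0 < b := Real.sqrt_pos.2 (by positivity)
  have htb : t < b := by nlinarith
  have hbs : b < s₂ := by nlinarith
  obtain ⟨f, hf, hfu⟩ := exists_contDiff_eq_on_ball hb0 hbs (L.contDiff.comp_contDiffOn hu)
  have hfb : ∀ M r, r ≤ b → (∀ x ∈ ball (0 : EuclideanSpace ℝ (Fin N)) r, ‖u x‖ ≤ M) →
      ∀ z ∈ ball (0 : EuclideanSpace ℝ (Fin (N + 1))) r,
        |harmonicExt k f z| ≤ Real.exp k * M := by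
    intro M r hr hM z hz
    rw [mem_ball_zero_iff] at hz
    have hPz : initL N z ∈ ball (0 : EuclideanSpace ℝ (Fin N)) r := by
      rw [mem_ball_zero_iff]; exact (norm_initL_le z).trans_lt hz
    rw [harmonicExt, abs_mul, Real.abs_exp, hfu _ (ball_subset_ball hr hPz), mul_comm]
    refine mul_le_mul ?_ ((hLle _).trans (hM _ hPz)) (abs_nonneg _) hE0.le
    refine Real.exp_le_exp.2 ?_
    have := last_le_norm z
    nlinarith
  have hharm : ∀ z ∈ ball (0 : EuclideanSpace ℝ (Fin (N + 1))) b,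
      lapR (harmonicExt k f) z = 0 := by
    intro z hz
    rw [mem_ball_zero_iff] at hz
    have hPz : initL N z ∈ ball (0 : EuclideanSpace ℝ (Fin N)) b := by
      rw [mem_ball_zero_iff]; exact (norm_initL_le z).trans_lt hz
    have hPz' := ball_subset_ball hbs.le hPz
    have hev : f =ᶠ[nhds (initL N z)] fun y => L (u y) := by
      filter_upwards [isOpen_ball.mem_nhds hPz] with y hy
      exact hfu y hy
    rw [lapR_harmonicExt k hf, lapR_comp_of_eventuallyEq L
      (hu.contDiffAt (isOpen_ball.mem_nhds hPz')) hev, hev.eq_of_nhds]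
    have : L (lapC u (initL N z)) + k ^ 2 * L (u (initL N z)) = 0 := by
      have h0 := congrArg L (hu0 _ hPz')
      have h1 : (k : ℂ) ^ 2 * u (initL N z) = (k ^ 2 : ℝ) • u (initL N z) := by
        rw [Complex.real_smul]; push_cast; rfl
      rwa [h1, map_add, map_smul, map_zero, smul_eq_mul] at h0
    rw [this, zero_mul]
  let z : EuclideanSpace ℝ (Fin (N + 1)) := WithLp.toLp 2 (Fin.snoc (fun i => x i) (0 : ℝ))
  have hzl : z (Fin.last N) = 0 := by simp [z]
  have hzx : initL N z = x := by
    ext i; rw [initL_apply]; simp [z]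
  have hzn : ‖z‖ ≤ s := by
    have h1 := norm_sq_eq_initL z
    rw [hzl, hzx] at h1
    rw [mem_ball_zero_iff] at hx
    nlinarith [norm_nonneg z, norm_nonneg x]
  have hxb : x ∈ ball (0 : EuclideanSpace ℝ (Fin N)) b := ball_subset_ball (hst.trans htb).le hx
  have hvz : harmonicExt k f z = ‖u x‖ := by
    rw [harmonicExt, hzl, hzx, hfu x hxb]
    simp [hL, hcu]
  have hl1 : 0 < Real.log (s₂ / t) := Real.log_pos ((one_lt_div ht).2 hts₂)
  have hl2 : 0 < Real.log (s₂ / s₁) := Real.log_pos ((one_lt_div hs₁).2 (hs₁t.trans hts₂))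
  have hl3 : 0 < Real.log (b / s₁) := Real.log_pos ((one_lt_div hs₁).2 (hs₁t.trans htb))
  have hlb : Real.log (b / t) = Real.log (s₂ / t) / 2 := by
    have h2 : (b / t) ^ 2 = s₂ / t := by rw [div_pow, hbsq]; field_simp
    rw [← h2, Real.log_pow]; push_cast; ring
  set γ := Real.log (s₂ / t) / Real.log (s₂ / s₁) / 4 with hγ
  have hγ0 : 0 ≤ γ := by positivity
  have hγle : γ ≤ Real.log (b / t) / Real.log (b / s₁) / 2 := by
    rw [hlb, hγ, div_right_comm _ 2, div_div _ (2 : ℝ) 2, show (2 : ℝ) * 2 = 4 by norm_num]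
    gcongr
  have key := abs_le_of_harmonic (contDiff_harmonicExt k hf) hharm hs₁ hs₁t hst htb le_rfl
    (mul_nonneg hE0.le hA) (mul_pos hE0 hB) (mul_le_mul_of_nonneg_left hAB hE0.le)
    (hfb A s₁ (hs₁t.trans htb).le hAu) (hfb B b le_rfl fun y hy =>
      hBu y (ball_subset_ball hbs.le hy)) hγ0 hγle hzn
  rw [hvz, mul_div_mul_left _ _ hE0.ne'] at key
  set D := 2 / (1 - s / t) with hD
  have hD0 : 0 < D := by positivity
  set q := A / B with hq
  have hq0 : 0 ≤ q := by positivity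
  have hBE : 0 < Real.exp k * B := by positivity
  set P := ‖u x‖ / (Real.exp k * B) with hP
  have hP0 : 0 ≤ P := by positivity
  have hP1 : P ≤ 1 := by
    rw [hP, div_le_one hBE]
    have h1 := hBu x (ball_subset_ball (hst.trans hts₂).le hx)
    nlinarith
  have hPsq : P ^ 2 ≤ D ^ (N + 2) * (q ^ γ) ^ 2 := by
    rw [hP, div_pow, div_le_iff₀ (by positivity)]
    calc _ ≤ _ := key
      _ = _ := by ring
  set l : ℝ := (N : ℝ) / (N + 2) with hl
  have hl0 : 0 ≤ l := by positivity
  have hl1' : l ≤ 1 := by rw [hl, div_le_one (by positivity)]; linarith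
  have hPfin : P ≤ D ^ ((N : ℝ) / 2) * q ^ (γ * l) := by
    calc P = P ^ (1 : ℝ) := (Real.rpow_one P).symm
      _ ≤ P ^ l := by
        rcases hP0.eq_or_lt with h | h
        · rw [← h, Real.zero_rpow one_ne_zero]
          exact Real.rpow_nonneg le_rfl _
        · exact Real.rpow_le_rpow_of_exponent_ge h hP1 hl1'
      _ = (P ^ 2) ^ (l / 2) := by
        rw [← Real.rpow_natCast, ← Real.rpow_mul hP0]; congr 1; push_cast; ring
      _ ≤ (D ^ (N + 2) * (q ^ γ) ^ 2) ^ (l / 2) :=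
        Real.rpow_le_rpow (by positivity) hPsq (by positivity)
      _ = D ^ ((N : ℝ) / 2) * q ^ (γ * l) := by
        rw [Real.mul_rpow (by positivity) (by positivity), ← Real.rpow_natCast,
          ← Real.rpow_natCast, ← Real.rpow_mul hD0.le, ← Real.rpow_mul hq0,
          ← Real.rpow_mul hq0]
        congr 2
        · push_cast; rw [hl]; field_simp
        · push_cast; ring
  have hexp : (N : ℝ) / (4 * (N + 2)) * Real.log (s₂ / t) / Real.log (s₂ / s₁) = γ * l := by
    rw [hγ, hl]; field_simp
  rw [hexp]
  rw [hP, div_le_iff₀ hBE] at hPfin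
  calc _ ≤ _ := hPfin
    _ = _ := by ring

/-- Three-spheres inequality for the Helmholtz equation: there are positive
constants `s̃₀`, `C̃` and `c̃₁ < 1`, depending only on `k` and `N`, such that for
every `0 < s₁ < s < s₂ ≤ s̃₀`, every `s < t < s₂` and every smooth solution `u` of
`Δu + k²u = 0` on `B_{s₂}`, there is `β` with
`c̃₁ log(s₂/t)/log(s₂/s₁) ≤ β ≤ 1 − c̃₁ log(t/s₁)/log(s₂/s₁)` such that
`‖u‖_{L^∞(B_s)} ≤ C̃ (1 − s/t)^{-N/2} ‖u‖_{L^∞(B_{s₂})}^{1−β} ‖u‖_{L^∞(B_{s₁})}^β`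
(the sup-norms are taken in `ℝ≥0∞` so that the inequality also covers unbounded
solutions). -/
theorem three_spheres_helmholtz (N : ℕ) (hN : 2 ≤ N) (k : ℝ) (hk : 0 < k) :
    ∃ s₀ > (0 : ℝ), ∃ C > (0 : ℝ), ∃ c₁ : ℝ, 0 < c₁ ∧ c₁ < 1 ∧
      ∀ s₁ s s₂ : ℝ, 0 < s₁ → s₁ < s → s < s₂ → s₂ ≤ s₀ →
      ∀ t : ℝ, s < t → t < s₂ →
      ∀ u : EuclideanSpace ℝ (Fin N) → ℂ,
        ContDiffOn ℝ (⊤ : ℕ∞) u (ball (0 : EuclideanSpace ℝ (Fin N)) s₂) →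
        (∀ x ∈ ball (0 : EuclideanSpace ℝ (Fin N)) s₂,
          lapC u x + ((k : ℂ)) ^ 2 * u x = 0) →
        ∃ β : ℝ,
          c₁ * Real.log (s₂ / t) / Real.log (s₂ / s₁) ≤ β ∧
          β ≤ 1 - c₁ * Real.log (t / s₁) / Real.log (s₂ / s₁) ∧
          (⨆ x ∈ ball (0 : EuclideanSpace ℝ (Fin N)) s, (‖u x‖₊ : ℝ≥0∞)) ≤
            ENNReal.ofReal (C * (1 - s / t) ^ (-(N : ℝ) / 2)) *
              (⨆ x ∈ ball (0 : EuclideanSpace ℝ (Fin N)) s₂, (‖u x‖₊ : ℝ≥0∞)) ^ (1 - β) *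
              (⨆ x ∈ ball (0 : EuclideanSpace ℝ (Fin N)) s₁, (‖u x‖₊ : ℝ≥0∞)) ^ β := by
  have hNpos : (0 : ℝ) < N := by exact_mod_cast (by omega : 0 < N)
  set c₁ : ℝ := (N : ℝ) / (4 * (N + 2)) with hc₁
  have hc₁0 : 0 < c₁ := by positivity
  have hc₁1 : c₁ < 1 := by rw [hc₁, div_lt_one (by positivity)]; linarith
  refine ⟨1, one_pos, Real.exp k * 2 ^ ((N : ℝ) / 2), by positivity, c₁, hc₁0, hc₁1, ?_⟩
  intro s₁ s s₂ hs₁ hs₁s hss₂ hs₂ t hst hts₂ u hu hu0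
  have hs : 0 < s := hs₁.trans hs₁s
  have ht : 0 < t := hs.trans hst
  have hs₂0 : 0 < s₂ := ht.trans hts₂
  have hs₁t : s₁ < t := hs₁s.trans hst
  have hδ : 0 < 1 - s / t := by rw [sub_pos, div_lt_one ht]; exact hst
  have hl1 : 0 < Real.log (s₂ / t) := Real.log_pos ((one_lt_div ht).2 hts₂)
  have hl2 : 0 < Real.log (s₂ / s₁) := Real.log_pos ((one_lt_div hs₁).2 (hs₁t.trans hts₂))
  have hl3 : 0 < Real.log (t / s₁) := Real.log_pos ((one_lt_div hs₁).2 hs₁t)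
  have hladd : Real.log (s₂ / t) + Real.log (t / s₁) = Real.log (s₂ / s₁) := by
    rw [Real.log_div hs₂0.ne' ht.ne', Real.log_div ht.ne' hs₁.ne',
      Real.log_div hs₂0.ne' hs₁.ne']
    ring
  set β := c₁ * Real.log (s₂ / t) / Real.log (s₂ / s₁) with hβ
  have hβ0 : 0 < β := by positivity
  have hβle : β ≤ 1 - c₁ * Real.log (t / s₁) / Real.log (s₂ / s₁) := by
    have : β + c₁ * Real.log (t / s₁) / Real.log (s₂ / s₁) = c₁ := by
      rw [hβ, ← add_div, ← mul_add, hladd, mul_div_cancel_right₀ _ hl2.ne']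
    linarith
  have hβ1 : β < 1 := by
    have : 0 < c₁ * Real.log (t / s₁) / Real.log (s₂ / s₁) := by positivity
    linarith
  refine ⟨β, le_rfl, hβle, ?_⟩
  have hu2 : ContDiffOn ℝ 2 u (ball 0 s₂) := hu.of_le (WithTop.coe_le_coe.2 (le_top : (2 : ℕ∞) ≤ ⊤))
  set C := Real.exp k * 2 ^ ((N : ℝ) / 2) * (1 - s / t) ^ (-(N : ℝ) / 2) with hC
  have hC0 : 0 < C := by positivity
  have hCeq : Real.exp k * (2 / (1 - s / t)) ^ ((N : ℝ) / 2) = C := by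
    rw [hC, Real.div_rpow zero_le_two hδ.le, neg_div, Real.rpow_neg hδ.le]
    ring
  set M : ℝ → ℝ≥0∞ := fun r => ⨆ x ∈ ball (0 : EuclideanSpace ℝ (Fin N)) r, (‖u x‖₊ : ℝ≥0∞)
    with hM
  have hMmono : ∀ {r r'}, r ≤ r' → M r ≤ M r' := fun h =>
    biSup_mono fun x hx => ball_subset_ball h hx
  have hle : ∀ {r} x, x ∈ ball (0 : EuclideanSpace ℝ (Fin N)) r → (‖u x‖₊ : ℝ≥0∞) ≤ M r :=
    fun x hx => le_biSup (fun x => (‖u x‖₊ : ℝ≥0∞)) hx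
  have hreal : ∀ {r} x, M r ≠ ⊤ → x ∈ ball (0 : EuclideanSpace ℝ (Fin N)) r →
      ‖u x‖ ≤ (M r).toReal := fun x hr hx => by
    simpa using ENNReal.toReal_mono hr (hle x hx)
  change M s ≤ ENNReal.ofReal C * M s₂ ^ (1 - β) * M s₁ ^ β
  have hCe : ENNReal.ofReal C ≠ 0 := by simpa using hC0
  rcases eq_or_ne (M s₁) 0 with h0 | h0
  · have hcont : ContinuousOn u (closedBall 0 ((t + s₂) / 2)) :=
      hu.continuousOn.mono (closedBall_subset_ball (by linarith))
    obtain ⟨B, hB⟩ := (isCompact_closedBall (0 : EuclideanSpace ℝ (Fin N))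
      ((t + s₂) / 2)).exists_bound_of_continuousOn hcont
    have hsub : ball (0 : EuclideanSpace ℝ (Fin N)) ((t + s₂) / 2) ⊆ ball 0 s₂ :=
      ball_subset_ball (by linarith)
    have hz : ∀ x ∈ ball (0 : EuclideanSpace ℝ (Fin N)) s, (‖u x‖₊ : ℝ≥0∞) = 0 := by
      intro x hx
      have h := norm_le_of_helmholtz (B := max B 1) hk hs₁ hs₁t hst (by linarith) (by linarith)
        (hu2.mono hsub) (fun y hy => hu0 y (hsub hy)) le_rfl (by positivity) (by positivity)
        (fun y hy => by simpa [h0] using hreal y (by simp [h0]) hy)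
        (fun y hy => (hB y (ball_subset_closedBall hy)).trans (le_max_left _ _)) hx
      have hl4 : 0 < Real.log ((t + s₂) / 2 / t) :=
        Real.log_pos ((one_lt_div ht).2 (by linarith))
      have hl5 : 0 < Real.log ((t + s₂) / 2 / s₁) :=
        Real.log_pos ((one_lt_div hs₁).2 (by linarith))
      rw [zero_div, Real.zero_rpow (by positivity), mul_zero, mul_zero] at h
      simpa using h
    have : M s = 0 := by simp only [hM, ENNReal.iSup_eq_zero]; exact hz
    rw [this]
    exact zero_le
  · rcases eq_or_ne (M s₂) ⊤ with htop | htop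
    · rw [htop, ENNReal.top_rpow_of_pos (by linarith), ENNReal.mul_top hCe, ENNReal.top_mul]
      · exact le_top
      · simp [ENNReal.rpow_eq_zero_iff, h0, hβ0.not_gt]
    · have hMs₁ : M s₁ ≠ ⊤ := ne_top_of_le_ne_top htop (hMmono (hs₁t.trans hts₂).le)
      have hMs₂ : M s₂ ≠ 0 := fun h => h0 (le_zero_iff.1 (h ▸ hMmono (hs₁t.trans hts₂).le))
      set A := (M s₁).toReal with hA
      set B := (M s₂).toReal with hB
      have hA0 : 0 < A := ENNReal.toReal_pos h0 hMs₁
      have hB0 : 0 < B := ENNReal.toReal_pos hMs₂ htop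
      have hrhs : ENNReal.ofReal C * M s₂ ^ (1 - β) * M s₁ ^ β =
          ENNReal.ofReal (C * (B * (A / B) ^ β)) := by
        have : C * (B * (A / B) ^ β) = C * B ^ (1 - β) * A ^ β := by
          rw [Real.div_rpow hA0.le hB0.le, Real.rpow_sub hB0, Real.rpow_one]
          ring
        rw [this, ENNReal.ofReal_mul (p := C * B ^ (1 - β)) (by positivity),
          ENNReal.ofReal_mul (p := C) hC0.le,
          ← ENNReal.ofReal_rpow_of_pos hB0, ← ENNReal.ofReal_rpow_of_pos hA0,
          ENNReal.ofReal_toReal hMs₁, ENNReal.ofReal_toReal htop]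
      rw [hrhs]
      refine iSup₂_le fun x hx => ?_
      rw [← ENNReal.ofReal_coe_nnreal, coe_nnnorm]
      refine ENNReal.ofReal_le_ofReal ?_
      rw [← hCeq]
      exact norm_le_of_helmholtz hk hs₁ hs₁t hst hts₂ hs₂ hu2 hu0 hA0.le hB0
        (ENNReal.toReal_mono htop (hMmono (hs₁t.trans hts₂).le))
        (fun y hy => hreal y hMs₁ hy) (fun y hy => hreal y htop hy) hx
end

section
/- The Kupradze tensor is a fundamental-type Navier solution off the diagonal (case N = 3): fix μ > 0, λ ∈ ℝ with λ + 2μ > 0, ρ > 0, ω > 0, and set ω_p = √(ρ/(λ+2μ)) ω, ω_s = √(ρ/μ) ω. For k > 0 let φ_k(x,y) = e^{i k ‖x−y‖}/(4π‖x−y‖) for x ≠ y in ℝ³, and define the 3×3 matrix Φ(x,y) = (1/μ) φ_{ω_s}(x,y) I₃ + (1/(ρω²)) ∇_x ∇_xᵀ [φ_{ω_s}(x,y) − φ_{ω_p}(x,y)]. Then for every fixed y ∈ ℝ³, each row of the map x ↦ Φ(x,y) is a solution of the Navier equation μ Δv + (λ+μ) ∇(div v) + ρω² v = 0 on ℝ³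 ∖ {y}. -/
open MeasureTheory Metric

/-- Entry `(i,j)` of the Jacobian matrix of a vector field `u : ℝ^N → ℂ^N`. -/
noncomputable def jac {N : ℕ} (u : EuclideanSpace ℝ (Fin N) → Fin N → ℂ)
    (x : EuclideanSpace ℝ (Fin N)) (i j : Fin N) : ℂ :=
  pdc (fun y => u y i) j x

/-- Divergence of a vector field `u : ℝ^N → ℂ^N`. -/
noncomputable def divC {N : ℕ} (u : EuclideanSpace ℝ (Fin N) → Fin N → ℂ)
    (x : EuclideanSpace ℝ (Fin N)) : ℂ :=
  ∑ i, jac u x i i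

/-- `u` solves the Navier equation `μ Δu + (λ+μ) ∇(div u) + ρω² u = 0` on `Ω`
(componentwise). -/
def NavierOn (mu lam rho om : ℝ) {N : ℕ}
    (u : EuclideanSpace ℝ (Fin N) → Fin N → ℂ)
    (Ω : Set (EuclideanSpace ℝ (Fin N))) : Prop :=
  ∀ x ∈ Ω, ∀ i, (mu : ℂ) * lapC (fun y => u y i) x
    + ((lam + mu : ℝ) : ℂ) * pdc (divC u) i x
    + ((rho * om ^ 2 : ℝ) : ℂ) * u x i = 0

/-- Longitudinal part `u_p = −∇(div u)/ω_p²`, with `ω_p² = ρω²/(λ+2μ)`. -/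
noncomputable def uLong (mu lam rho om : ℝ) {N : ℕ}
    (u : EuclideanSpace ℝ (Fin N) → Fin N → ℂ)
    (x : EuclideanSpace ℝ (Fin N)) (i : Fin N) : ℂ :=
  -pdc (divC u) i x / ((rho * om ^ 2 / (lam + 2 * mu) : ℝ) : ℂ)

/-- Transversal part `u_s = (∇(div u) − Δu)/ω_s²`, with `ω_s² = ρω²/μ`. -/
noncomputable def uTrans (mu rho om : ℝ) {N : ℕ}
    (u : EuclideanSpace ℝ (Fin N) → Fin N → ℂ)
    (x : EuclideanSpace ℝ (Fin N)) (i : Fin N) : ℂ :=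
  (pdc (divC u) i x - lapC (fun y => u y i) x) / ((rho * om ^ 2 / mu : ℝ) : ℂ)

/-- Fundamental solution `φ_k(x,y) = e^{ik‖x−y‖}/(4π‖x−y‖)` of the Helmholtz
equation in `ℝ³`. -/
noncomputable def phiK (k : ℝ) (x y : EuclideanSpace ℝ (Fin 3)) : ℂ :=
  Complex.exp (Complex.I * ((k * dist x y : ℝ) : ℂ)) / (((4 * Real.pi * dist x y : ℝ)) : ℂ)

/-- The Kupradze tensor
`Φ(x,y) = (1/μ) φ_{ω_s}(x,y) I₃ + (1/(ρω²)) ∇_x∇_xᵀ[φ_{ω_s}(x,y) − φ_{ω_p}(x,y)]`,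
with `ω_p = √(ρ/(λ+2μ)) ω` and `ω_s = √(ρ/μ) ω`. -/
noncomputable def kupradzeTensor (mu lam rho om : ℝ)
    (x y : EuclideanSpace ℝ (Fin 3)) (i j : Fin 3) : ℂ :=
  ((1 / mu : ℝ) : ℂ) * phiK (Real.sqrt (rho / mu) * om) x y * (if i = j then 1 else 0)
    + ((1 / (rho * om ^ 2) : ℝ) : ℂ) *
        pdc (fun z => pdc (fun w => phiK (Real.sqrt (rho / mu) * om) w y
          - phiK (Real.sqrt (rho / (lam + 2 * mu)) * om) w y) j z) i x

section PartialDerivatives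

open scoped ContDiff

variable {N : ℕ} {Ω : Set (EuclideanSpace ℝ (Fin N))} {f g : EuclideanSpace ℝ (Fin N) → ℂ}

theorem pdc_congr (hΩ : IsOpen Ω) (h : Set.EqOn f g Ω) (j : Fin N) :
    Set.EqOn (pdc f j) (pdc g j) Ω := fun x hx => by
  have : f =ᶠ[nhds x] g := Filter.eventuallyEq_of_mem (hΩ.mem_nhds hx) h
  simp only [pdc, this.fderiv_eq]

theorem contDiffOn_pdc (hΩ : IsOpen Ω) (hf : ContDiffOn ℝ ∞ f Ω) (j : Fin N) :
    ContDiffOn ℝ ∞ (pdc f j) Ω :=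
  (hf.fderiv_of_isOpen (m := ∞) hΩ (by simp)).clm_apply contDiffOn_const

theorem ContDiffOn.differentiableAt_of_isOpen (hΩ : IsOpen Ω) (hf : ContDiffOn ℝ ∞ f Ω)
    {x : EuclideanSpace ℝ (Fin N)} (hx : x ∈ Ω) : DifferentiableAt ℝ f x :=
  (hf.contDiffAt (hΩ.mem_nhds hx)).differentiableAt (by simp)

theorem pdc_linear_comb (hΩ : IsOpen Ω) (hf : ContDiffOn ℝ ∞ f Ω) (hg : ContDiffOn ℝ ∞ g Ω)
    (a b : ℂ) (j : Fin N) :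
    Set.EqOn (pdc (fun x => a * f x + b * g x) j) (fun x => a * pdc f j x + b * pdc g j x) Ω := by
  intro x hx
  have hf' := hf.differentiableAt_of_isOpen hΩ hx
  have hg' := hg.differentiableAt_of_isOpen hΩ hx
  have := ((hf'.hasFDerivAt.const_mul a).add (hg'.hasFDerivAt.const_mul b)).fderiv
  simp only [pdc]
  erw [this]
  simp

theorem pdc_sum (hΩ : IsOpen Ω) {ι : Type*} (s : Finset ι)
    {F : ι → EuclideanSpace ℝ (Fin N) → ℂ}
    (hF : ∀ k, ContDiffOn ℝ ∞ (F k) Ω) (j : Fin N) :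
    Set.EqOn (pdc (fun x => ∑ k ∈ s, F k x) j) (fun x => ∑ k ∈ s, pdc (F k) j x) Ω := by
  intro x hx
  simp only [pdc]
  rw [fderiv_fun_sum fun k _ => (hF k).differentiableAt_of_isOpen hΩ hx]
  simp

theorem pdc_comm (hΩ : IsOpen Ω) (hf : ContDiffOn ℝ ∞ f Ω) (i j : Fin N) :
    Set.EqOn (pdc (pdc f i) j) (pdc (pdc f j) i) Ω := by
  intro x hx
  have hd : DifferentiableAt ℝ (fderiv ℝ f) x :=
    (((hf.fderiv_of_isOpen (m := ∞) hΩ (by simp)).contDiffAt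
      (hΩ.mem_nhds hx)).differentiableAt (by simp))
  have key (i j : Fin N) : pdc (pdc f i) j x =
      fderiv ℝ (fderiv ℝ f) x (EuclideanSpace.single j 1) (EuclideanSpace.single i 1) := by
    have := (hd.hasFDerivAt.clm_apply
      (hasFDerivAt_const (EuclideanSpace.single i (1 : ℝ)) x)).fderiv
    change fderiv ℝ (fun z => fderiv ℝ f z (EuclideanSpace.single i 1)) x _ = _
    rw [this]
    simp
  rw [key, key]
  exact ((hf.contDiffAt (hΩ.mem_nhds hx)).isSymmSndFDerivAt
    (by simpa using WithTop.coe_le_coe.2 (le_top : (2 : ℕ∞) ≤ ⊤))).eq _ _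

theorem lapC_congr (hΩ : IsOpen Ω) (h : Set.EqOn f g Ω) : Set.EqOn (lapC f) (lapC g) Ω :=
  fun _ hx => Finset.sum_congr rfl fun j _ => pdc_congr hΩ (pdc_congr hΩ h j) j hx

theorem lapC_linear_comb (hΩ : IsOpen Ω) (hf : ContDiffOn ℝ ∞ f Ω) (hg : ContDiffOn ℝ ∞ g Ω)
    (a b : ℂ) :
    Set.EqOn (lapC (fun x => a * f x + b * g x)) (fun x => a * lapC f x + b * lapC g x) Ω := by
  intro x hx
  simp only [lapC, Finset.mul_sum, ← Finset.sum_add_distrib]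
  refine Finset.sum_congr rfl fun j _ => ?_
  rw [pdc_congr hΩ (pdc_linear_comb hΩ hf hg a b j) j hx,
    pdc_linear_comb hΩ (contDiffOn_pdc hΩ hf j) (contDiffOn_pdc hΩ hg j) a b j hx]

theorem lapC_pdc (hΩ : IsOpen Ω) (hf : ContDiffOn ℝ ∞ f Ω) (i : Fin N) :
    Set.EqOn (lapC (pdc f i)) (pdc (lapC f) i) Ω := by
  intro x hx
  change _ = pdc (fun x => ∑ j, pdc (pdc f j) j x) i x
  rw [pdc_sum hΩ _ (fun j => contDiffOn_pdc hΩ (contDiffOn_pdc hΩ hf j) j) i hx]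
  refine Finset.sum_congr rfl fun j _ => ?_
  rw [pdc_congr hΩ (pdc_comm hΩ hf i j) j hx, pdc_comm hΩ (contDiffOn_pdc hΩ hf j) i j hx]

/-- A Helmholtz eigenrelation `Δf = c f` passes to partial derivatives. -/
theorem lapC_pdc_of_eigen (hΩ : IsOpen Ω) (hf : ContDiffOn ℝ ∞ f Ω) {c : ℂ}
    (h : Set.EqOn (lapC f) (fun x => c * f x) Ω) (i : Fin N) :
    Set.EqOn (lapC (pdc f i)) (fun x => c * pdc f i x) Ω := by
  intro x hx
  rw [lapC_pdc hΩ hf i hx, pdc_congr hΩ h i hx]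
  simpa using pdc_linear_comb hΩ hf hf c 0 i hx

/-- If `S`, `P` satisfy Helmholtz equations with squared wave numbers `ρω²/μ` and `ρω²/(λ+2μ)`,
then each row of `μ⁻¹ S I + (ρω²)⁻¹ ∇∇ᵀ(S - P)` solves the Navier equation. -/
theorem navierOn_of_helmholtz {mu lam rho om : ℝ} (hΩ : IsOpen Ω)
    (hmu : mu ≠ 0) (hlam : lam + 2 * mu ≠ 0) (hrho : rho ≠ 0) (hom : om ≠ 0)
    {S P : EuclideanSpace ℝ (Fin N) → ℂ}
    (hS : ContDiffOn ℝ ∞ S Ω) (hP : ContDiffOn ℝ ∞ P Ω)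
    (hSl : Set.EqOn (lapC S) (fun x => -((rho / mu * om ^ 2 : ℝ) : ℂ) * S x) Ω)
    (hPl : Set.EqOn (lapC P) (fun x => -((rho / (lam + 2 * mu) * om ^ 2 : ℝ) : ℂ) * P x) Ω)
    (i : Fin N) :
    NavierOn mu lam rho om (fun x j => ((1 / mu : ℝ) : ℂ) * S x * (if i = j then 1 else 0)
      + ((1 / (rho * om ^ 2) : ℝ) : ℂ) * pdc (fun z => pdc (fun w => S w - P w) j z) i x) Ω := by
  set a : ℂ := ((1 / mu : ℝ) : ℂ) with ha
  set b : ℂ := ((1 / (rho * om ^ 2) : ℝ) : ℂ) with hb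
  set D : EuclideanSpace ℝ (Fin N) → ℂ := fun w => 1 * S w + (-1) * P w with hD
  have hDS : (fun w => S w - P w) = D := by ext w; simp [hD, sub_eq_add_neg]
  rw [hDS]
  have hDc : ContDiffOn ℝ ∞ D Ω := (contDiffOn_const.mul hS).add (contDiffOn_const.mul hP)
  have hD1 (j : Fin N) := contDiffOn_pdc hΩ hDc j
  have hD2 (j k : Fin N) := contDiffOn_pdc hΩ (hD1 j) k
  have hDpd (j : Fin N) := pdc_linear_comb hΩ hS hP 1 (-1) j
  have hDpd2 (j k : Fin N) : Set.EqOn (pdc (pdc D j) k)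
      (fun x => 1 * pdc (pdc S j) k x + (-1) * pdc (pdc P j) k x) Ω := fun x hx => by
    rw [pdc_congr hΩ (hDpd j) k hx,
      pdc_linear_comb hΩ (contDiffOn_pdc hΩ hS j) (contDiffOn_pdc hΩ hP j) 1 (-1) k hx]
  have hu (j : Fin N) :
      (fun x => a * S x * (if i = j then 1 else 0) + b * pdc (fun z => pdc D j z) i x)
        = fun x => (a * (if i = j then 1 else 0)) * S x + b * pdc (pdc D j) i x := by
    ext x; ring
  set cS : ℂ := -((rho / mu * om ^ 2 : ℝ) : ℂ) with hcS
  set cP : ℂ := -((rho / (lam + 2 * mu) * om ^ 2 : ℝ) : ℂ) with hcP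
  have hmu' : (mu : ℂ) ≠ 0 := by exact_mod_cast hmu
  have hlam' : (lam + 2 * mu : ℂ) ≠ 0 := by exact_mod_cast hlam
  have hrho' : (rho : ℂ) ≠ 0 := by exact_mod_cast hrho
  have hom' : (om : ℂ) ≠ 0 := by exact_mod_cast hom
  have hdiv : Set.EqOn (divC fun x j => a * S x * (if i = j then 1 else 0)
      + b * pdc (fun z => pdc D j z) i x)
      (fun x => (-(b * cP)) * pdc P i x + 0 * pdc P i x) Ω := by
    intro x hx
    have h1 : ∀ j, pdc (fun x => a * S x * (if i = j then 1 else 0)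
        + b * pdc (fun z => pdc D j z) i x) j x
        = (a * (if i = j then 1 else 0)) * pdc S j x + b * pdc (pdc (pdc D j) j) i x := by
      intro j
      rw [hu j, pdc_linear_comb hΩ hS (hD2 j i) _ _ j hx]
      beta_reduce
      rw [pdc_comm hΩ (hD1 j) i j hx]
    have hlapD : pdc (lapC D) i x = cS * pdc S i x - cP * pdc P i x := by
      rw [← lapC_pdc hΩ hDc i hx, lapC_congr hΩ (hDpd i) hx,
        lapC_linear_comb hΩ (contDiffOn_pdc hΩ hS i) (contDiffOn_pdc hΩ hP i) _ _ hx]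
      simp only [lapC_pdc_of_eigen hΩ hS hSl i hx, lapC_pdc_of_eigen hΩ hP hPl i hx]
      ring
    have h2 : ∑ j, pdc (pdc (pdc D j) j) i x = cS * pdc S i x - cP * pdc P i x := by
      rw [← hlapD]
      exact (pdc_sum hΩ _ (fun j => hD2 j j) i hx).symm
    simp only [divC, jac, h1, Finset.sum_add_distrib, ← Finset.mul_sum, h2]
    have habS : a + b * cS = 0 := by
      rw [ha, hb, hcS]; push_cast; field_simp; ring
    simp only [mul_ite, mul_one, mul_zero, ite_mul, zero_mul, Finset.sum_ite_eq,
      Finset.mem_univ, if_true]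
    linear_combination pdc S i x * habS
  intro x hx j
  rw [pdc_congr hΩ hdiv j hx,
    pdc_linear_comb hΩ (contDiffOn_pdc hΩ hP i) (contDiffOn_pdc hΩ hP i) _ _ j hx, hu j,
    lapC_linear_comb hΩ hS (hD2 j i) _ _ hx]
  beta_reduce
  rw [lapC_congr hΩ (hDpd2 j i) hx,
    lapC_linear_comb hΩ (contDiffOn_pdc hΩ (contDiffOn_pdc hΩ hS j) i)
      (contDiffOn_pdc hΩ (contDiffOn_pdc hΩ hP j) i) _ _ hx]
  simp only [hSl hx,
    lapC_pdc_of_eigen hΩ (contDiffOn_pdc hΩ hS j) (lapC_pdc_of_eigen hΩ hS hSl j) i hx,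
    lapC_pdc_of_eigen hΩ (contDiffOn_pdc hΩ hP j) (lapC_pdc_of_eigen hΩ hP hPl j) i hx,
    pdc_comm hΩ hP i j hx]
  change _ + _ + _ * (a * S x * _ + b * pdc (pdc D j) i x) = 0
  rw [hDpd2 j i hx, ha, hb, hcS, hcP]
  obtain ⟨L, hL⟩ : ∃ L : ℂ, (lam : ℂ) = L - 2 * mu := ⟨lam + 2 * mu, by ring⟩
  push_cast
  rw [hL, sub_add_cancel] at hlam' ⊢
  field_simp
  ring

end PartialDerivatives

section Radial

open scoped ContDiff

variable {N : ℕ} {x y : EuclideanSpace ℝ (Fin N)}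

theorem hasFDerivAt_dist_left (h : x ≠ y) :
    HasFDerivAt (fun w => dist w y) ((dist x y)⁻¹ • innerSL ℝ (x - y)) x := by
  have h0 : ‖x - y‖ ≠ 0 := norm_ne_zero_iff.2 (sub_ne_zero.2 h)
  have h1 := (((hasFDerivAt_id x).sub_const y).norm_sq).sqrt (pow_ne_zero 2 h0)
  simp only [id, Real.sqrt_sq (norm_nonneg _)] at h1
  simp only [← dist_eq_norm] at h1
  refine h1.congr_fderiv ?_
  ext v
  simp
  field_simp

/-- Partial derivatives of a radial function `F(‖x - y‖)`. -/
theorem pdc_radial {F : ℝ → ℂ} {F' : ℂ} (h : x ≠ y) (hF : HasDerivAt F F' (dist x y))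
    (j : Fin N) :
    pdc (fun w => F (dist w y)) j x = F' / (dist x y : ℂ) * ((x j - y j : ℝ) : ℂ) := by
  have := (hF.hasFDerivAt.comp x (hasFDerivAt_dist_left h)).fderiv
  simp only [pdc]
  erw [this]
  simp [EuclideanSpace.inner_single_right]
  ring

/-- Laplacian of a radial function `F(‖x - y‖)`, where `G` is `F'(r) / r`. -/
theorem lapC_radial {F G : ℝ → ℂ} {G' : ℂ} (h : x ≠ y)
    (hF : ∀ r, 0 < r → HasDerivAt F (r * G r) r) (hG : HasDerivAt G G' (dist x y)) :
    lapC (fun w => F (dist w y)) x = dist x y * G' + N * G (dist x y) := by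
  have hr : (dist x y : ℂ) ≠ 0 := by exact_mod_cast (dist_pos.2 h).ne'
  have h1 (j : Fin N) : Set.EqOn (pdc (fun w => F (dist w y)) j)
      (fun w => G (dist w y) * ((w j - y j : ℝ) : ℂ)) {y}ᶜ := fun w hw => by
    have hw' : (dist w y : ℂ) ≠ 0 := by exact_mod_cast (dist_pos.2 hw).ne'
    rw [pdc_radial hw (hF _ (dist_pos.2 hw))]
    field_simp
  have h2 (j : Fin N) : pdc (pdc (fun w => F (dist w y)) j) j x
      = G' / dist x y * (((x j - y j) ^ 2 : ℝ) : ℂ) + G (dist x y) := by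
    rw [pdc_congr isOpen_compl_singleton (h1 j) j h]
    have hc : HasFDerivAt (fun w : EuclideanSpace ℝ (Fin N) => ((w j - y j : ℝ) : ℂ))
        (Complex.ofRealCLM ∘L EuclideanSpace.proj j) x :=
      Complex.ofRealCLM.hasFDerivAt.comp x
        ((EuclideanSpace.proj (𝕜 := ℝ) j).hasFDerivAt.sub_const (y j))
    have hg := hG.hasFDerivAt.comp x (hasFDerivAt_dist_left h)
    have := (hg.mul hc).fderiv
    simp only [pdc]
    erw [this]
    simp [EuclideanSpace.inner_single_right]
    ring
  have h3 : ∑ j, (x j - y j) ^ 2 = dist x y ^ 2 := by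
    rw [EuclideanSpace.dist_eq, Real.sq_sqrt (by positivity)]
    simp [Real.dist_eq]
  simp only [lapC, h2, Finset.sum_add_distrib, ← Finset.mul_sum, ← Complex.ofReal_sum, h3]
  simp
  field_simp

end Radial

theorem contDiffOn_phiK (k : ℝ) (y : EuclideanSpace ℝ (Fin 3)) {n : WithTop ℕ∞} :
    ContDiffOn ℝ n (fun x => phiK k x y) {y}ᶜ := by
  intro x hx
  have hd : ContDiffAt ℝ n (fun w => dist w y) x :=
    contDiffAt_id.dist ℝ contDiffAt_const hx
  have hc {c : ℝ} : ContDiffAt ℝ n (fun w => ((c * dist w y : ℝ) : ℂ)) x :=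
    Complex.ofRealCLM.contDiff.contDiffAt.comp x (contDiffAt_const.mul hd)
  refine ContDiffAt.contDiffWithinAt ?_
  simp only [phiK, div_eq_mul_inv]
  refine (contDiffAt_const.mul hc).cexp.mul (hc.inv ?_)
  exact_mod_cast mul_ne_zero (by positivity) (dist_pos.2 hx).ne'

/-- The Helmholtz equation `Δφ_k = -k² φ_k` off the singularity. -/
theorem lapC_phiK (k : ℝ) (y : EuclideanSpace ℝ (Fin 3)) :
    Set.EqOn (lapC fun x => phiK k x y) (fun x => -((k ^ 2 : ℝ) : ℂ) * phiK k x y) {y}ᶜ := by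
  intro x hx
  set F : ℝ → ℂ := fun r =>
    Complex.exp (Complex.I * ((k * r : ℝ) : ℂ)) / ((4 * Real.pi * r : ℝ) : ℂ) with hFdef
  set G : ℝ → ℂ := fun r => (Complex.I * k / r - 1 / (r : ℂ) ^ 2) * F r with hGdef
  have hpi : (Real.pi : ℂ) ≠ 0 := by exact_mod_cast Real.pi_ne_zero
  have hof (r : ℝ) : HasDerivAt (fun r : ℝ => (r : ℂ)) 1 r := Complex.ofRealCLM.hasDerivAt
  have hF : ∀ r, 0 < r → HasDerivAt F (r * G r) r := by
    intro r hr
    have hr' : (r : ℂ) ≠ 0 := by exact_mod_cast hr.ne'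
    have h1 : HasDerivAt (fun r : ℝ => Complex.exp (Complex.I * ((k : ℂ) * r)) /
        (4 * Real.pi * (r : ℂ))) _ r :=
      ((((hof r).const_mul (k : ℂ)).const_mul Complex.I).cexp).div
        ((hof r).const_mul (4 * (Real.pi : ℂ))) (by simp [hpi, hr'])
    simp only [hGdef, hFdef]
    push_cast
    refine h1.congr_deriv ?_
    field_simp
  have hr := dist_pos.2 hx
  have hr' : (dist x y : ℂ) ≠ 0 := by exact_mod_cast hr.ne'
  have hG := (((hasDerivAt_const (dist x y) (Complex.I * k)).div (hof _) hr').sub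
    ((hasDerivAt_const (dist x y) (1 : ℂ)).div ((hof _).pow 2) (pow_ne_zero 2 hr'))).mul (hF _ hr)
  have := lapC_radial (F := F) (G := G) hx hF hG
  change lapC (fun w => F (dist w y)) x = _ * F (dist x y)
  rw [this]
  simp [hGdef]
  field_simp
  ring_nf
  simp only [Complex.I_sq]
  ring

/-- The Kupradze tensor is a fundamental-type Navier solution off the diagonal
(case `N = 3`): for every fixed `y ∈ ℝ³`, each row of `x ↦ Φ(x,y)` solves the
Navier equation `μΔv + (λ+μ)∇(div v) + ρω²v = 0` on `ℝ³ ∖ {y}`. -/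
theorem kupradze_tensor_solves_navier (mu lam rho om : ℝ)
    (hmu : 0 < mu) (hlam : 0 < lam + 2 * mu) (hrho : 0 < rho) (hom : 0 < om) :
    ∀ y : EuclideanSpace ℝ (Fin 3), ∀ i : Fin 3,
      NavierOn mu lam rho om
        (fun x j => kupradzeTensor mu lam rho om x y i j)
        ({y}ᶜ : Set (EuclideanSpace ℝ (Fin 3))) := by
  intro y i
  have hsq {a : ℝ} (ha : 0 ≤ a) : (Real.sqrt a * om) ^ 2 = a * om ^ 2 := by
    rw [mul_pow, Real.sq_sqrt ha]
  refine navierOn_of_helmholtz isOpen_compl_singleton hmu.ne' hlam.ne' hrho.ne' hom.ne'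
    (contDiffOn_phiK _ y) (contDiffOn_phiK _ y) ?_ ?_ i
  · rw [← hsq (by positivity)]
    exact lapC_phiK _ y
  · rw [← hsq (by positivity)]
    exact lapC_phiK _ y
end
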